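/- For n ≥ 1 and λ = μ = (n) (both factors n-cycles), the number of ways to write a fixed n-cycle as a product of two n-cycles is c^n_{(n),(n)} = (1/n) Σ_{r=0}^{n-1} (-1)^r r! (n-1-r)!. -/

import Mathlib

open Equiv Finset MvPolynomial

/-- `σ` has cycle type `lam` (cycle lengths including fixed points). -/
def hasCycleType {n : ℕ} (σ : Perm (Fin n)) (lam : n.Partition) : Prop :=
  σ.partition.parts = lam.parts

/-- number of pairs `(α, β)` with cycle types `lam`, `mu` and `α * β = σ`. -/
noncomputable def numFactorizations (n : ℕ) (lam mu : n.Partition) (σ : Perm (Fin n)) : ℕ :=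
  Nat.card {p : Perm (Fin n) × Perm (Fin n) //
    hasCycleType p.1 lam ∧ hasCycleType p.2 mu ∧ p.1 * p.2 = σ}

/-- `z_λ = ∏ i, α_i! i^{α_i}`, the order of the centralizer. -/
def zPart {n : ℕ} (lam : n.Partition) : ℕ :=
  ∏ i ∈ Finset.range (n + 1),
    (Nat.factorial (Multiset.count i lam.parts)) * i ^ (Multiset.count i lam.parts)

/-- The irreducible character `χ^ρ` of `S_n` evaluated at class `μ`, via the
Frobenius character formula: the coefficient of `x^{ρ + δ}` in `a_δ ⬝ p_μ`. -/
noncomputable def charSn (n : ℕ) (ρ μ : n.Partition) : ℤ :=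
  MvPolynomial.coeff
    (Finsupp.equivFunOnFinite.symm fun i : Fin n =>
      ((ρ.parts.sort (· ≤ ·)).reverse.getD i 0) + (n - 1 - (i : ℕ)))
    ((∏ i : Fin n, ∏ j ∈ Finset.univ.filter (fun j => i < j),
        (X i - X j : MvPolynomial (Fin n) ℤ)) *
      (μ.parts.map (fun k => ∑ j : Fin n, (X j : MvPolynomial (Fin n) ℤ) ^ k)).prod)

/-- The hook partition `(n-r, 1^r)` of `n`. -/
def hookPartition (n r : ℕ) (h : r < n) : n.Partition :=
  ⟨(n - r) ::ₘ Multiset.replicate r 1, by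
    intro i hi
    rcases Multiset.mem_cons.mp hi with h1 | h1
    · omega
    · simp [Multiset.eq_of_mem_replicate h1],
   by simp [Multiset.sum_replicate]; omega⟩

/-- The partition `1^n` of `n`. -/
def onesPartition (n : ℕ) : n.Partition :=
  ⟨Multiset.replicate n 1, by
    intro i hi
    simp [Multiset.eq_of_mem_replicate hi], by simp⟩

section IsCycleOn

variable {X : Type*}

lemma mem_of_sameCycle [Finite X] {g : Perm X} {s : Set X} (hs : ∀ x ∈ s, g x ∈ s)
    {x y : X} (hx : x ∈ s) (h : g.SameCycle x y) : y ∈ s := by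
  obtain ⟨i, -, rfl⟩ := h.exists_pow_eq'
  clear h
  induction i with
  | zero => simpa using hx
  | succ i ih => rw [pow_succ', Perm.mul_apply]; exact hs _ ih

lemma isCycleOn_coe_of_sameCycle {g : Perm X} {S : Finset X} (h : ∀ x, g x ∈ S ↔ x ∈ S)
    (hc : ∀ x ∈ S, ∀ y ∈ S, g.SameCycle x y) : g.IsCycleOn (S : Set X) := by
  refine ⟨⟨fun x hx => by simpa [h] using hx, g.injective.injOn, fun y hy => ?_⟩, ?_⟩
  · exact ⟨g⁻¹ y, (h (g⁻¹ y)).1 (by simpa using hy), by simp⟩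
  · exact fun x hx y hy => hc x hx y hy

lemma isCycleOn_univ_iff_of_base (g : Perm X) (z : X) :
    g.IsCycleOn Set.univ ↔ ∀ x, g.SameCycle z x := by
  refine ⟨fun h x => h.2 trivial trivial, fun h => ⟨?_, fun x _ y _ => (h x).symm.trans (h y)⟩⟩
  exact Set.bijOn_univ.2 g.bijective

end IsCycleOn

section Restrict

variable {X : Type*} [DecidableEq X]

/-- The permutation that acts as `g` on `S` and trivially elsewhere, when `S` is `g`-invariant. -/
noncomputable def restrictTo (g : Perm X) (S : Finset X) : Perm X :=
  open Classical in
  if h : ∀ x, g x ∈ S ↔ x ∈ S then Perm.ofSubtype (g.subtypePerm h) else 1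

lemma restrictTo_apply {g : Perm X} {S : Finset X} (h : ∀ x, g x ∈ S ↔ x ∈ S) (x : X) :
    restrictTo g S x = if x ∈ S then g x else x := by
  rw [restrictTo, dif_pos h]
  split_ifs with hx
  · exact Perm.ofSubtype_subtypePerm_of_mem h hx
  · exact Perm.ofSubtype_subtypePerm_of_not_mem h hx

lemma restrictTo_mul {g g' : Perm X} {S : Finset X} (h : ∀ x, g x ∈ S ↔ x ∈ S)
    (h' : ∀ x, g' x ∈ S ↔ x ∈ S) :
    restrictTo (g * g') S = restrictTo g S * restrictTo g' S := by
  ext x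
  have hh : ∀ x, (g * g') x ∈ S ↔ x ∈ S := fun x => by simp [h, h']
  rw [Perm.mul_apply, restrictTo_apply hh, restrictTo_apply h, restrictTo_apply h']
  by_cases hx : x ∈ S <;> simp [hx, h']

lemma restrictTo_swap {a b : X} {S : Finset X} (ha : a ∈ S) (hb : b ∈ S) :
    restrictTo (swap a b) S = swap a b := by
  have h : ∀ x, swap a b x ∈ S ↔ x ∈ S := fun x => by
    rw [swap_apply_def]; split_ifs with h1 h2 <;> simp_all
  ext x
  rw [restrictTo_apply h]
  split_ifs with hx
  · rfl
  · rw [swap_apply_of_ne_of_ne] <;> rintro rfl <;> contradiction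

lemma restrictTo_union {g : Perm X} {S T : Finset X} (hS : ∀ x, g x ∈ S ↔ x ∈ S)
    (hT : ∀ x, g x ∈ T ↔ x ∈ T) (hd : Disjoint S T) :
    restrictTo g (S ∪ T) = restrictTo g S * restrictTo g T := by
  have hh : ∀ x, g x ∈ S ∪ T ↔ x ∈ S ∪ T := fun x => by simp [hS, hT]
  ext x
  rw [Perm.mul_apply, restrictTo_apply hh, restrictTo_apply hS, restrictTo_apply hT]
  by_cases hxT : x ∈ T
  · have : x ∉ S := Finset.disjoint_right.1 hd hxT
    have : g x ∉ S := by rwa [hS]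
    simp [*]
  · simp [hxT]

variable [Fintype X]

lemma sign_restrictTo_of_isCycleOn {g : Perm X} {S : Finset X} (hS : S.Nonempty)
    (hg : g.IsCycleOn (S : Set X)) :
    (Perm.sign (restrictTo g S) : ℤ) = -(-1) ^ #S := by
  have h : ∀ x, g x ∈ S ↔ x ∈ S := fun x => by simpa using hg.apply_mem_iff (x := x)
  rcases hS.exists_eq_singleton_or_nontrivial with ⟨x, rfl⟩ | hS
  · have : restrictTo g {x} = 1 := by
      ext y
      rw [restrictTo_apply h]
      split_ifs with hy
      · have := (h x).2 (by simp)
        simp_all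
      · rfl
    simp [this]
  · have hc : (restrictTo g S).IsCycle := by
      rw [restrictTo, dif_pos h]
      have := (hg.isCycle_subtypePerm hS)
      exact this.extendDomain _
    have hsupp : (restrictTo g S).support = S := by
      ext x
      rw [Perm.mem_support, restrictTo_apply h]
      by_cases hx : x ∈ S
      · simpa [hx] using hg.apply_ne hS hx
      · simp [hx]
    rw [hc.sign, hsupp]
    simp

/-- The signed contribution of a set `S` to the principal-minor expansion of `1 - g`. -/
noncomputable def invariantWeight (g : Perm X) (S : Finset X) : ℤ :=
  open Classical in
  if ∀ x, g x ∈ S ↔ x ∈ S then (-1) ^ #S * (Perm.sign (restrictTo g S) : ℤ) else 0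

lemma invariantWeight_union_cycle {g : Perm X} {S T : Finset X} (hS : ∀ x, g x ∈ S ↔ x ∈ S)
    (hT : g.IsCycleOn (T : Set X)) (hne : T.Nonempty) (hd : Disjoint S T) :
    invariantWeight g (S ∪ T) = -invariantWeight g S := by
  have hT' : ∀ x, g x ∈ T ↔ x ∈ T := fun x => by simpa using hT.apply_mem_iff (x := x)
  have hh : ∀ x, g x ∈ S ∪ T ↔ x ∈ S ∪ T := fun x => by simp [hS, hT']
  rw [invariantWeight, invariantWeight, if_pos hS, if_pos hh, restrictTo_union hS hT' hd,
    card_union_of_disjoint hd, Perm.sign_mul, Units.val_mul, sign_restrictTo_of_isCycleOn hne hT,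
    pow_add]
  have : ((-1 : ℤ) ^ #T) * (-1) ^ #T = 1 := by rw [← mul_pow]; simp
  linear_combination (-(-1) ^ #S * (Perm.sign (restrictTo g S) : ℤ)) * this

lemma invariantWeight_empty (g : Perm X) : invariantWeight g ∅ = 1 := by
  have : restrictTo g ∅ = 1 := by
    ext x
    rw [restrictTo_apply (by simp)]
    simp
  simp [invariantWeight, this]

open Classical in
/-- A principal-minor form of the matrix-tree theorem for functional digraphs of permutations. -/
lemma sum_invariantWeight (g : Perm X) (z : X) :
    ∑ S ∈ (univ.erase z).powerset, invariantWeight g S =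
      if g.IsCycleOn Set.univ then 1 else 0 := by
  split_ifs with hg
  · rw [Finset.sum_eq_single ∅, invariantWeight_empty]
    · intro S hS hne
      rw [invariantWeight, if_neg]
      intro h
      obtain ⟨x, hx⟩ := Finset.nonempty_iff_ne_empty.2 hne
      have : z ∈ (S : Set X) :=
        mem_of_sameCycle (fun x hx => by simpa [h] using hx) (by simpa using hx)
          (hg.2 (Set.mem_univ x) (Set.mem_univ z))
      have h2 := Finset.mem_powerset.1 hS this
      simp at h2
    · simp
  · rw [isCycleOn_univ_iff_of_base g z] at hg
    push Not at hg
    obtain ⟨y, hy⟩ := hg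
    set T : Finset X := univ.filter fun x => g.SameCycle y x with hTdef
    have hzT : z ∉ T := by simpa [hTdef] using fun h => hy h.symm
    have hyT : y ∈ T := by simp [hTdef, Perm.SameCycle.rfl]
    have hTinv : ∀ x, g x ∈ T ↔ x ∈ T := fun x => by simp [hTdef]
    have hT : g.IsCycleOn (T : Set X) := isCycleOn_coe_of_sameCycle hTinv fun a ha b hb => by
      simp only [hTdef, Finset.mem_filter] at ha hb
      exact ha.2.symm.trans hb.2
    have hdich : ∀ S : Finset X, (∀ x, g x ∈ S ↔ x ∈ S) → y ∈ S → T ⊆ S := fun S hS hyS x hx => by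
      have : x ∈ (S : Set X) := mem_of_sameCycle (fun x hx => by simpa [hS] using hx)
        (by simpa using hyS) (Finset.mem_filter.1 hx).2
      simpa using this
    have hdis : ∀ S : Finset X, (∀ x, g x ∈ S ↔ x ∈ S) → y ∉ S → Disjoint S T :=
      fun S hS hyS => Finset.disjoint_left.2 fun x hxS hx => hyS <| by
        have : y ∈ (S : Set X) := mem_of_sameCycle (fun x hx => by simpa [hS] using hx)
          (by simpa using hxS) (Finset.mem_filter.1 hx).2.symm
        simpa using this
    have hne (S : Finset X) (h : invariantWeight g S ≠ 0) : ∀ x, g x ∈ S ↔ x ∈ S := by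
      by_contra hS
      exact h (if_neg hS)
    rw [← Finset.sum_filter_of_ne (p := fun S => ∀ x, g x ∈ S ↔ x ∈ S) fun S _ h => hne S h]
    refine Finset.sum_involution (fun S _ => if y ∈ S then S \ T else S ∪ T) ?_ ?_ ?_ ?_
    · intro S hS
      obtain ⟨-, hS⟩ := Finset.mem_filter.1 hS
      split_ifs with hyS
      · have := invariantWeight_union_cycle (S := S \ T) (g := g)
          (fun x => by simp [hS, hTinv]) hT ⟨y, hyT⟩ Finset.sdiff_disjoint
        rw [Finset.sdiff_union_of_subset (hdich S hS hyS)] at this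
        simp [this]
      · rw [invariantWeight_union_cycle hS hT ⟨y, hyT⟩ (hdis S hS hyS)]
        simp
    · intro S hS _ h
      split_ifs at h with hyS
      · rw [← h] at hyS
        simp [hyT] at hyS
      · rw [← h] at hyS
        simp [hyT] at hyS
    · intro S hS
      simp only [Finset.mem_filter, Finset.mem_powerset] at hS ⊢
      split_ifs with hyS
      · exact ⟨Finset.sdiff_subset.trans hS.1, fun x => by simp [hS.2, hTinv]⟩
      · refine ⟨Finset.union_subset hS.1 fun x hx => ?_, fun x => by simp [hS.2, hTinv]⟩
        simp only [Finset.mem_erase, Finset.mem_univ, and_true]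
        rintro rfl
        exact hzT hx
    · intro S hS
      obtain ⟨-, hS⟩ := Finset.mem_filter.1 hS
      by_cases hyS : y ∈ S
      · simp [hyS, hyT, hdich S hS hyS]
      · simp only [hyS, hyT, if_false, Finset.mem_union, or_true, if_true]
        exact Finset.union_sdiff_cancel_right (hdis S hS hyS)

end Restrict

section FullCycles

variable {X : Type*} [Fintype X] [DecidableEq X]

lemma isCycleOn_of_swap_mul {α : Perm X} (hα : α.IsCycleOn Set.univ) {a b : X} {S : Finset X}
    (ha : a ∉ S) (hS : ∀ x, (swap a b * α) x ∈ S ↔ x ∈ S) :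
    (swap a b * α).IsCycleOn (S : Set X) := by
  set β := swap a b * α with hβ
  have hα' : ∀ x, α x = swap a b (β x) := fun x => by simp [hβ]
  have key : ∀ y, β.SameCycle b y ∨ β.SameCycle a y := fun y => by
    refine mem_of_sameCycle (s := {y | β.SameCycle b y ∨ β.SameCycle a y}) (g := α)
      (fun x hx => ?_) (x := b) (Or.inl Perm.SameCycle.rfl)
      (hα.2 (Set.mem_univ b) (Set.mem_univ y))
    rw [hα', Set.mem_ofPred_eq, swap_apply_def]
    split_ifs with h1 h2
    · exact Or.inl Perm.SameCycle.rfl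
    · exact Or.inr Perm.SameCycle.rfl
    · simpa using hx
  have hb' : ∀ y ∈ S, β.SameCycle b y := fun y hy => by
    refine (key y).resolve_right fun h => ha ?_
    exact mem_of_sameCycle (s := (S : Set X)) (fun x hx => by simpa [hS] using hx)
      (by simpa using hy) h.symm
  exact isCycleOn_coe_of_sameCycle hS fun x hx y hy => (hb' x hx).symm.trans (hb' y hy)

lemma isCycleOn_compl_of_swap_mul {α : Perm X} (hα : α.IsCycleOn Set.univ) {a b : X}
    {S : Finset X} (hb : b ∈ S) (hS : ∀ x, (swap a b * α) x ∈ S ↔ x ∈ S) :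
    (swap a b * α).IsCycleOn ((Sᶜ : Finset X) : Set X) := by
  rw [swap_comm] at hS ⊢
  exact isCycleOn_of_swap_mul hα (by simpa using hb) fun x => by
    rw [Finset.mem_compl, Finset.mem_compl, hS]

/-- Multiplying by a transposition joins two complementary cycles. -/
lemma isCycleOn_univ_swap_mul {β : Perm X} {a b : X} {S : Finset X} (ha : a ∉ S) (hb : b ∈ S)
    (hS : β.IsCycleOn (S : Set X)) (hSc : β.IsCycleOn ((Sᶜ : Finset X) : Set X)) :
    (swap a b * β).IsCycleOn Set.univ := by
  have hinv : ∀ x, β x ∈ S ↔ x ∈ S := fun x => by simpa using hS.apply_mem_iff (x := x)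
  set α := swap a b * β with hα
  have hβ : ∀ x, β x = swap a b (α x) := fun x => by simp [hα]
  have hab : α.SameCycle b a := by
    by_contra hab
    have hcl : ∀ x ∈ {x | α.SameCycle b x ∧ x ∈ S}, β x ∈ {x | α.SameCycle b x ∧ x ∈ S} := by
      rintro x ⟨hx, hxS⟩
      have h1 : α.SameCycle b (α x) := by simpa using hx
      refine ⟨?_, (hinv x).2 hxS⟩
      rw [hβ, swap_apply_def]
      split_ifs with h2 h3
      · exact Perm.SameCycle.rfl
      · have : β x = a := by rw [hβ, h3, swap_apply_right]
        exact absurd ((hinv x).2 hxS) (this ▸ ha)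
      · exact h1
    have hmem : β⁻¹ b ∈ {x | α.SameCycle b x ∧ x ∈ S} :=
      mem_of_sameCycle hcl ⟨Perm.SameCycle.rfl, hb⟩ (by simp [Perm.SameCycle.rfl])
    have : α (β⁻¹ b) = a := by simp [hα]
    exact hab (this ▸ (Perm.sameCycle_apply_right.2 hmem.1))
  rw [isCycleOn_univ_iff_of_base _ b]
  have hcl : ∀ x ∈ {x | α.SameCycle b x}, β x ∈ {x | α.SameCycle b x} := by
    intro x hx
    rw [Set.mem_ofPred_eq, hβ, swap_apply_def]
    split_ifs with h2 h3
    · exact Perm.SameCycle.rfl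
    · exact hab
    · simpa using hx
  intro x
  by_cases hx : x ∈ S
  · exact mem_of_sameCycle hcl (x := b) Perm.SameCycle.rfl (hS.2 (by simpa using hb) hx)
  · exact mem_of_sameCycle hcl (x := a) hab (hSc.2 (by simpa using ha) (by simpa using hx))

lemma cycleType_eq_singleton_card_iff (hX : 2 ≤ Fintype.card X) (g : Perm X) :
    g.cycleType = {Fintype.card X} ↔ g.IsCycleOn Set.univ := by
  have : Nontrivial X := Fintype.one_lt_card_iff_nontrivial.1 hX
  constructor
  · intro h
    have hc : g.IsCycle := by rw [← Perm.card_cycleType_eq_one, h]; simp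
    have hs : g.support = univ := by
      rw [hc.cycleType, Multiset.singleton_inj] at h
      exact (Finset.card_eq_iff_eq_univ _).1 h
    have := hc.isCycleOn
    rwa [Set.eq_univ_of_forall (s := {x | g x ≠ x}) fun x =>
      Perm.mem_support.1 (hs ▸ Finset.mem_univ x)] at this
  · intro h
    have hne : ∀ x, g x ≠ x := fun x => h.apply_ne Set.nontrivial_univ (Set.mem_univ x)
    have hc : g.IsCycle := by
      rw [Perm.isCycle_iff_exists_isCycleOn]
      exact ⟨Set.univ, Set.nontrivial_univ, h, fun _ _ => Set.mem_univ _⟩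
    rw [hc.cycleType, Finset.eq_univ_iff_forall.2 fun x => Perm.mem_support.2 (hne x),
      Finset.card_univ]

open Classical in
lemma card_isCycleOn_univ [Nonempty X] :
    #{g : Perm X | g.IsCycleOn Set.univ} = (Fintype.card X - 1).factorial := by
  rcases Nat.lt_or_ge (Fintype.card X) 2 with h | h
  · have : Subsingleton X := Fintype.card_le_one_iff_subsingleton.1 (by omega)
    have hc : Fintype.card X = 1 := by have := Fintype.card_pos (α := X); omega
    rw [Finset.filter_true_of_mem fun g _ => Perm.isCycleOn_of_subsingleton g _, Finset.card_univ,
      Fintype.card_perm, hc]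
    rfl
  · simp_rw [← cycleType_eq_singleton_card_iff h]
    rw [Perm.card_of_cycleType_singleton h le_rfl]
    simp

lemma isCycleOn_subtypeCongr_iff {S : Finset X} (p : Perm {x // x ∈ S})
    (q : Perm {x // x ∉ S}) :
    ((p.subtypeCongr q).IsCycleOn (S : Set X) ∧
      (p.subtypeCongr q).IsCycleOn ((Sᶜ : Finset X) : Set X)) ↔
      p.IsCycleOn Set.univ ∧ q.IsCycleOn Set.univ := by
  have hz : ∀ k : ℤ, (p.subtypeCongr q) ^ k = (p ^ k).subtypeCongr (q ^ k) := fun k =>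
    (map_zpow (Perm.subtypeCongrHom (· ∈ S)) (p, q) k).symm
  have hinv : ∀ x, p.subtypeCongr q x ∈ S ↔ x ∈ S := fun x => by
    by_cases hx : x ∈ S
    · simp [Perm.subtypeCongr.left_apply, hx]
    · simp only [Perm.subtypeCongr.right_apply p q hx, hx, iff_false]
      exact (q ⟨x, hx⟩).2
  have hp : ∀ x y : {x // x ∈ S}, (p.subtypeCongr q).SameCycle x y ↔ p.SameCycle x y :=
    fun x y => exists_congr fun k => by
      rw [hz, Perm.subtypeCongr.left_apply_subtype, Subtype.ext_iff]
  have hq : ∀ x y : {x // x ∉ S}, (p.subtypeCongr q).SameCycle x y ↔ q.SameCycle x y :=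
    fun x y => exists_congr fun k => by
      rw [hz, Perm.subtypeCongr.right_apply_subtype, Subtype.ext_iff]
  constructor
  · rintro ⟨h1, h2⟩
    refine ⟨⟨Set.bijOn_univ.2 p.bijective, fun x _ y _ => (hp x y).1 (h1.2 x.2 y.2)⟩,
      ⟨Set.bijOn_univ.2 q.bijective, fun x _ y _ => (hq x y).1 (h2.2 ?_ ?_)⟩⟩
    · simp
    · simp
  · rintro ⟨h1, h2⟩
    refine ⟨isCycleOn_coe_of_sameCycle hinv fun x hx y hy =>
        (hp ⟨x, hx⟩ ⟨y, hy⟩).2 (h1.2 (Set.mem_univ _) (Set.mem_univ _)),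
      isCycleOn_coe_of_sameCycle (fun x => by simp [hinv]) fun x hx y hy =>
        (hq ⟨x, by simpa using hx⟩ ⟨y, by simpa using hy⟩).2
          (h2.2 (Set.mem_univ _) (Set.mem_univ _))⟩

open Classical in
lemma card_isCycleOn_and_compl {S : Finset X} (hS : S.Nonempty) (hSc : Sᶜ.Nonempty) :
    #{g : Perm X | g.IsCycleOn (S : Set X) ∧ g.IsCycleOn ((Sᶜ : Finset X) : Set X)} =
      (#S - 1).factorial * (Fintype.card X - #S - 1).factorial := by
  have : Nonempty {x // x ∈ S} := hS.to_subtype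
  have : Nonempty {x // x ∉ S} := by
    obtain ⟨x, hx⟩ := hSc
    exact ⟨⟨x, by simpa using hx⟩⟩
  have h1 := card_isCycleOn_univ (X := {x // x ∈ S})
  have h2 := card_isCycleOn_univ (X := {x // x ∉ S})
  rw [Fintype.card_coe] at h1
  rw [Fintype.card_subtype_compl, Fintype.card_coe] at h2
  rw [← h1, ← h2, ← Finset.card_product]
  symm
  refine Finset.card_bij (fun pq _ => pq.1.subtypeCongr pq.2) ?_ ?_ ?_
  · rintro ⟨p, q⟩ h
    rw [Finset.mem_filter, isCycleOn_subtypeCongr_iff]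
    simpa using h
  · rintro a - b - h
    exact Perm.subtypeCongrHom_injective _ h
  · intro g hg
    simp only [Finset.mem_filter, Finset.mem_univ, true_and] at hg
    have h1 : ∀ x, g x ∈ S ↔ x ∈ S := fun x => by simpa using hg.1.apply_mem_iff (x := x)
    have h2 : ∀ x, g x ∉ S ↔ x ∉ S := fun x => (h1 x).not
    have hg' : (g.subtypePerm h1).subtypeCongr (g.subtypePerm h2) = g := by
      ext x
      by_cases hx : x ∈ S
      · simp [Perm.subtypeCongr.left_apply, hx]
      · simp [Perm.subtypeCongr.right_apply, hx]
    refine ⟨(g.subtypePerm h1, g.subtypePerm h2), ?_, hg'⟩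
    rw [← hg', isCycleOn_subtypeCongr_iff] at hg
    simpa using hg

open Classical in
lemma sum_invariantWeight_mul_eq_zero (σ : Perm X) {S : Finset X} {a a' : X} (haa : a ≠ a')
    (ha : a ∉ S) (ha' : a' ∉ S) (hσa : σ a ∈ S) (hσa' : σ a' ∈ S) :
    ∑ α : Perm X with α.IsCycleOn Set.univ, invariantWeight (σ * α) S = 0 := by
  have hτS : ∀ x ∈ S, swap a a' x = x := fun x hx => by
    rw [swap_apply_of_ne_of_ne] <;> rintro rfl <;> contradiction
  have hτ : ∀ x, swap a a' x ∈ S ↔ x ∈ S := fun x => by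
    rw [swap_apply_def]; split_ifs with h1 h2 <;> simp_all
  have hτ1 : restrictTo (swap a a') S = 1 := by
    ext x
    rw [restrictTo_apply hτ]
    split_ifs with hx
    · exact hτS x hx
    · rfl
  have hu : ∀ x, swap (σ a) (σ a') x ∈ S ↔ x ∈ S := fun x => by
    rw [swap_apply_def]; split_ifs with h1 h2 <;> simp_all
  have hconj : ∀ α : Perm X, σ * (swap a a' * α * swap a a') =
      swap (σ a) (σ a') * (σ * α) * swap a a' := fun α => by
    rw [← mul_assoc (swap (σ a) (σ a')), ← Equiv.mul_swap_eq_swap_mul]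
    simp only [mul_assoc]
  have key : ∀ α : Perm X, invariantWeight (σ * α) S +
      invariantWeight (σ * (swap a a' * α * swap a a')) S = 0 := fun α => by
    simp only [hconj]
    rw [invariantWeight, invariantWeight]
    have hiff : (∀ x, (swap (σ a) (σ a') * (σ * α) * swap a a') x ∈ S ↔ x ∈ S) ↔
        ∀ x, (σ * α) x ∈ S ↔ x ∈ S := by
      constructor
      · intro h x
        have := h (swap a a' x)
        rw [Perm.mul_apply, Perm.mul_apply, ← Perm.mul_apply (swap a a'), swap_mul_self,
          Perm.one_apply, hu, hτ] at this
        exact this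
      · intro h x
        rw [Perm.mul_apply, Perm.mul_apply, hu, h, hτ]
    by_cases h : ∀ x, (σ * α) x ∈ S ↔ x ∈ S
    · rw [if_pos h, if_pos (hiff.2 h), restrictTo_mul (fun x => by rw [Perm.mul_apply, hu, h]) hτ,
        restrictTo_mul hu h, restrictTo_swap hσa hσa', hτ1]
      simp [Perm.sign_swap (σ.injective.ne haa)]
    · rw [if_neg h, if_neg (hiff.not.2 h), add_zero]
  refine Finset.sum_involution (fun α _ => swap a a' * α * swap a a') (fun α _ => key α) ?_ ?_ ?_
  · intro α _ hne heq
    have := key α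
    rw [heq] at this
    omega
  · intro α hα
    simp only [Finset.mem_filter, Finset.mem_univ, true_and] at hα ⊢
    have := hα.conj (g := swap a a')
    simpa using this
  · intro α _
    simp [mul_assoc]

open Classical in
lemma sum_invariantWeight_mul_of_swap {σ : Perm X} (hσ : σ.IsCycleOn Set.univ) {S : Finset X}
    {a b : X} (ha : a ∉ S) (hb : b ∈ S) (hS : ∀ x, σ x ∈ S ↔ swap a b x ∈ S) :
    ∑ α : Perm X with α.IsCycleOn Set.univ, invariantWeight (σ * α) S =
      (-1) ^ #S * ((#S - 1).factorial * (Fintype.card X - #S - 1).factorial : ℕ) := by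
  have hSne : S.Nonempty := ⟨b, hb⟩
  have hστ : ∀ x, (σ * swap a b) x ∈ S ↔ x ∈ S := fun x => by
    rw [Perm.mul_apply, hS, ← Perm.mul_apply, swap_mul_self, Perm.one_apply]
  have hσsign : (Perm.sign (restrictTo (σ * swap a b) S) : ℤ) = -(-1) ^ #S := by
    refine sign_restrictTo_of_isCycleOn hSne ?_
    rw [Equiv.mul_swap_eq_swap_mul, swap_comm] at hστ ⊢
    have h2 : σ b ∉ S := by rw [hS, swap_apply_right]; exact ha
    exact isCycleOn_of_swap_mul hσ h2 hστ
  have hinv : ∀ α : Perm X, (∀ x, (σ * α) x ∈ S ↔ x ∈ S) ↔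
      ∀ x, (swap a b * α) x ∈ S ↔ x ∈ S := fun α =>
    forall_congr' fun x => by rw [Perm.mul_apply, hS, Perm.mul_apply]
  have hw : ∀ α : Perm X, α.IsCycleOn Set.univ → invariantWeight (σ * α) S =
      if ∀ x, (swap a b * α) x ∈ S ↔ x ∈ S then (-1) ^ #S else 0 := fun α hα => by
    rw [invariantWeight]
    simp only [hinv]
    split_ifs with h
    · have : σ * α = (σ * swap a b) * (swap a b * α) := by simp [mul_assoc]
      rw [this, restrictTo_mul hστ h, Perm.sign_mul, Units.val_mul, hσsign,
        sign_restrictTo_of_isCycleOn hSne (isCycleOn_of_swap_mul hα ha h), neg_mul_neg,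
        ← mul_pow]
      simp
    · rfl
  rw [Finset.sum_congr rfl fun α hα => hw α (Finset.mem_filter.1 hα).2, ← Finset.sum_filter,
    Finset.sum_const, Finset.filter_filter, nsmul_eq_mul, mul_comm,
    ← card_isCycleOn_and_compl hSne ⟨a, by simpa using ha⟩]
  congr 2
  refine Finset.card_bij' (fun α _ => swap a b * α) (fun β _ => swap a b * β) ?_ ?_ ?_ ?_
  · intro α hα
    simp only [Finset.mem_filter, Finset.mem_univ, true_and] at hα ⊢
    exact ⟨isCycleOn_of_swap_mul hα.1 ha hα.2, isCycleOn_compl_of_swap_mul hα.1 hb hα.2⟩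
  · intro β hβ
    simp only [Finset.mem_filter, Finset.mem_univ, true_and] at hβ ⊢
    refine ⟨isCycleOn_univ_swap_mul ha hb hβ.1 hβ.2, fun x => ?_⟩
    rw [swap_mul_self_mul]
    simpa using hβ.1.apply_mem_iff (x := x)
  · intro α _
    simp
  · intro α _
    simp

end FullCycles

section FinRotate

lemma isCycleOn_univ_finRotate (m : ℕ) : (finRotate (m + 1)).IsCycleOn Set.univ := by
  cases m with
  | zero =>
    have : Subsingleton (Fin (0 + 1)) := Fin.subsingleton_one
    exact Perm.isCycleOn_of_subsingleton _ _
  | succ m =>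
    rw [← cycleType_eq_singleton_card_iff (by simp), Fintype.card_fin, cycleType_finRotate]

open Classical in
lemma sum_invariantWeight_finRotate_Ioc (m : ℕ) {a b : Fin (m + 1)} (hab : a < b) :
    ∑ α : Perm (Fin (m + 1)) with α.IsCycleOn Set.univ,
        invariantWeight (finRotate (m + 1) * α) (Ioc a b) =
      (-1) ^ (b - a : ℕ) * ((b - a - 1 : ℕ).factorial * (m - (b - a) : ℕ).factorial : ℕ) := by
  rw [sum_invariantWeight_mul_of_swap (isCycleOn_univ_finRotate m) (a := a) (b := b) (by simp)
    (by simpa using hab),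
    Fin.card_Ioc, Fintype.card_fin]
  · congr 4
    omega
  · intro x
    have hx := coe_finRotate x
    have hlast : x = Fin.last m ↔ (x : ℕ) = m := by simp [Fin.ext_iff]
    rw [Finset.mem_Ioc, Finset.mem_Ioc, swap_apply_def]
    simp only [Fin.lt_def, Fin.le_def, hx, hlast, Fin.ext_iff] at hab ⊢
    split_ifs <;> omega

/-- A set avoiding `0` that is entered at most once by the rotation is an interval. -/
lemma eq_empty_or_eq_Ioc_of_finRotate {m : ℕ} {S : Finset (Fin (m + 1))} (h0 : 0 ∉ S)
    (h : ∀ a a', a ∉ S → a' ∉ S → finRotate (m + 1) a ∈ S → finRotate (m + 1) a' ∈ S → a = a') :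
    S = ∅ ∨ ∃ a b, a < b ∧ S = Ioc a b := by
  rcases S.eq_empty_or_nonempty with rfl | hS
  · exact Or.inl rfl
  right
  have hsucc : ∀ x : Fin (m + 1), ∀ y : Fin (m + 1), (y : ℕ) = x + 1 → finRotate (m + 1) x = y :=
    fun x y hxy => by
      have := y.2
      rw [Fin.ext_iff, coe_finRotate, if_neg (by rw [Fin.ext_iff, Fin.val_last]; omega), hxy]
  have hc := S.min'_mem hS
  have hb := S.max'_mem hS
  set c := S.min' hS with hcdef
  set b := S.max' hS with hbdef
  have hc0 : (c : ℕ) ≠ 0 := fun h => h0 (by rwa [show (0 : Fin (m + 1)) = c from Fin.ext h.symm])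
  have hcb : c ≤ b := S.min'_le _ hb
  obtain ⟨a, ha⟩ : ∃ a : Fin (m + 1), (c : ℕ) = a + 1 :=
    ⟨⟨c - 1, by omega⟩, by simp only []; omega⟩
  have haS : a ∉ S := fun h => by
    have := Fin.le_def.1 (S.min'_le a h)
    omega
  have hac : finRotate (m + 1) a ∈ S := by rwa [hsucc a c ha]
  have hmem : ∀ d : ℕ, ∀ x : Fin (m + 1), (x : ℕ) + d = b → a < x → x ∈ S := by
    intro d
    induction d with
    | zero =>
      intro x hx _
      rwa [show x = b from Fin.ext hx]
    | succ d ih =>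
      intro x hx hax
      by_contra hxS
      have hy : (⟨x + 1, by omega⟩ : Fin (m + 1)) ∈ S :=
        ih _ (by simp only []; omega) (by rw [Fin.lt_def] at hax ⊢; simp only []; omega)
      exact hax.ne (h a x haS hxS hac (by rwa [hsucc x ⟨x + 1, by omega⟩ rfl]))
  refine ⟨a, b, by rw [Fin.lt_def]; rw [Fin.le_def] at hcb; omega, ?_⟩
  ext x
  rw [Finset.mem_Ioc]
  constructor
  · intro hx
    refine ⟨?_, S.le_max' x hx⟩
    have := Fin.le_def.1 (S.min'_le x hx)
    rw [Fin.lt_def]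
    omega
  · rintro ⟨h1, h2⟩
    exact hmem (b - x) x (by rw [Fin.le_def] at h2; omega) h1

open Classical in
lemma card_isCycleOn_finRotate_mul (m : ℕ) :
    (#{α : Perm (Fin (m + 1)) | α.IsCycleOn Set.univ ∧
        (finRotate (m + 1) * α).IsCycleOn Set.univ} : ℤ) =
      m.factorial + ∑ p : Fin (m + 1) × Fin (m + 1) with p.1 < p.2,
        (-1 : ℤ) ^ (p.2 - p.1 : ℕ) *
          ((p.2 - p.1 - 1 : ℕ).factorial * (m - (p.2 - p.1) : ℕ).factorial : ℕ) := by
  rw [← Finset.filter_filter, Finset.card_filter, Nat.cast_sum]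
  simp_rw [Nat.cast_ite, Nat.cast_one, Nat.cast_zero, ← sum_invariantWeight _ (0 : Fin (m + 1))]
  rw [Finset.sum_comm]
  set F : Finset (Fin (m + 1)) → ℤ := fun S =>
    ∑ α : Perm (Fin (m + 1)) with α.IsCycleOn Set.univ,
      invariantWeight (finRotate (m + 1) * α) S with hF
  set P : Finset (Fin (m + 1) × Fin (m + 1)) := {p | p.1 < p.2} with hP
  have hP' : ∀ p, p ∈ P ↔ p.1 < p.2 := fun p => by simp [hP]
  have hFempty : F ∅ = m.factorial := by
    simp only [hF, invariantWeight_empty, Finset.sum_const, card_isCycleOn_univ, Fintype.card_fin]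
    simp
  have hinj : Set.InjOn (fun p : Fin (m + 1) × Fin (m + 1) => Ioc p.1 p.2) P := by
    rintro ⟨a, b⟩ hp ⟨a', b'⟩ hp' heq
    have hp := (hP' _).1 hp
    have hp' := (hP' _).1 hp'
    simp only [] at hp hp' heq
    have h1 : ∀ x, (a < x ∧ x ≤ b) ↔ (a' < x ∧ x ≤ b') := fun x => by
      rw [← Finset.mem_Ioc, heq, Finset.mem_Ioc]
    have hb : b = b' := le_antisymm ((h1 b).1 ⟨hp, le_rfl⟩).2 ((h1 b').2 ⟨hp', le_rfl⟩).2
    subst hb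
    refine Prod.ext (le_antisymm ?_ ?_) rfl
    · by_contra! hlt
      exact lt_irrefl a ((h1 a).2 ⟨hlt, hp.le⟩).1
    · by_contra! hlt
      exact lt_irrefl a' ((h1 a').1 ⟨hlt, hp'.le⟩).1
  have hnot : ∅ ∉ P.image fun p => Ioc p.1 p.2 := by
    simp only [Finset.mem_image, not_exists, not_and, Finset.Ioc_eq_empty_iff, not_not]
    exact fun p hp => (hP' p).1 hp
  calc ∑ S ∈ (univ.erase (0 : Fin (m + 1))).powerset, F S
      = ∑ S ∈ insert ∅ (P.image fun p => Ioc p.1 p.2), F S := by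
        symm
        refine Finset.sum_subset ?_ fun S hS hS' => ?_
        · intro S hS
          rw [Finset.mem_powerset]
          intro x hx
          rw [Finset.mem_insert, Finset.mem_image] at hS
          rcases hS with rfl | ⟨p, -, rfl⟩
          · simp at hx
          · simp only [Finset.mem_erase, Finset.mem_univ, and_true]
            exact Fin.pos_iff_ne_zero.1 ((Fin.zero_le _).trans_lt (Finset.mem_Ioc.1 hx).1)
        · by_contra hne
          have h0 : (0 : Fin (m + 1)) ∉ S := fun h => by
            simpa using Finset.mem_powerset.1 hS h
          refine hS' ?_
          rw [Finset.mem_insert, Finset.mem_image]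
          refine (eq_empty_or_eq_Ioc_of_finRotate h0 fun a a' ha ha' hσa hσa' => ?_).imp_right ?_
          · by_contra haa
            exact hne (sum_invariantWeight_mul_eq_zero _ haa ha ha' hσa hσa')
          · rintro ⟨a, b, hab, rfl⟩
            exact ⟨(a, b), (hP' _).2 hab, rfl⟩
    _ = F ∅ + ∑ p ∈ P, F (Ioc p.1 p.2) := by
        rw [Finset.sum_insert hnot, Finset.sum_image hinj]
    _ = _ := by
        rw [hFempty]
        congr 1
        exact Finset.sum_congr rfl fun p hp =>
          sum_invariantWeight_finRotate_Ioc m ((hP' p).1 hp)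

end FinRotate

lemma sum_range_sum_range_sub (f : ℕ → ℚ) (n : ℕ) :
    ∑ b ∈ range n, ∑ a ∈ range b, f (b - a - 1) = ∑ k ∈ range n, ((n : ℚ) - 1 - k) * f k := by
  induction n with
  | zero => simp
  | succ n ih =>
    have h : ∑ a ∈ range n, f (n - a - 1) = ∑ k ∈ range n, f k := by
      rw [← Finset.sum_range_reflect f n]
      exact Finset.sum_congr rfl fun a ha => by congr 1; omega
    rw [Finset.sum_range_succ, ih, h, Finset.sum_range_succ, ← Finset.sum_add_distrib]
    push_cast
    simp only [add_sub_cancel_right, sub_self, zero_mul, add_zero]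
    exact Finset.sum_congr rfl fun k _ => by ring

lemma sum_alternating_factorial_mul_factorial (m : ℕ) :
    ((m : ℚ) + 2) * ∑ r ∈ range (m + 1), (-1 : ℚ) ^ r * r.factorial * (m - r).factorial =
      (1 + (-1) ^ m) * (m + 1).factorial := by
  have h : ∀ r ∈ range (m + 1),
      ((m : ℚ) + 2) * ((-1 : ℚ) ^ r * r.factorial * (m - r).factorial) =
        (-1) ^ r * r.factorial * (m + 1 - r).factorial -
          (-1) ^ (r + 1) * (r + 1).factorial * (m + 1 - (r + 1)).factorial := fun r hr => by
    have hr : r ≤ m := Nat.lt_succ_iff.1 (Finset.mem_range.1 hr)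
    obtain ⟨d, rfl⟩ := Nat.exists_eq_add_of_le hr
    rw [show r + d + 1 - r = d + 1 by omega, show r + d + 1 - (r + 1) = d by omega,
      show r + d - r = d by omega, Nat.factorial_succ, Nat.factorial_succ]
    push_cast
    ring
  rw [Finset.mul_sum, Finset.sum_congr rfl h, Finset.sum_range_sub']
  simp
  ring

lemma factorial_add_sum_eq (m : ℕ) :
    (m.factorial : ℚ) + ∑ b ∈ range (m + 1), ∑ a ∈ range b, (-1 : ℚ) ^ (b - a) *
        ((b - a - 1).factorial * (m - (b - a)).factorial) =
      1 / ((m : ℚ) + 1) *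
        ∑ r ∈ range (m + 1), (-1 : ℚ) ^ r * r.factorial * (m - r).factorial := by
  have h1 : ∑ b ∈ range (m + 1), ∑ a ∈ range b, (-1 : ℚ) ^ (b - a) *
        ((b - a - 1).factorial * (m - (b - a)).factorial) =
      ∑ b ∈ range (m + 1), ∑ a ∈ range b, (fun k => (-1 : ℚ) ^ (k + 1) *
        (k.factorial * (m - (k + 1)).factorial)) (b - a - 1) := by
    refine Finset.sum_congr rfl fun b _ => Finset.sum_congr rfl fun a ha => ?_
    have : b - a - 1 + 1 = b - a := by have := Finset.mem_range.1 ha; omega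
    simp only [this]
  have h2 := sum_alternating_factorial_mul_factorial m
  rw [h1, sum_range_sum_range_sub (fun k => (-1 : ℚ) ^ (k + 1) *
    (k.factorial * (m - (k + 1)).factorial)), Finset.sum_range_succ]
  rw [Finset.sum_range_succ] at h2 ⊢
  have h3 : ∀ k ∈ range m, (((m + 1 : ℕ) : ℚ) - 1 - k) *
      ((-1 : ℚ) ^ (k + 1) * (k.factorial * (m - (k + 1)).factorial)) =
        -((-1 : ℚ) ^ k * k.factorial * (m - k).factorial) := fun k hk => by
    obtain ⟨d, rfl⟩ := Nat.exists_eq_add_of_lt (Finset.mem_range.1 hk)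
    rw [show k + d + 1 - (k + 1) = d by omega, show k + d + 1 - k = d + 1 by omega,
      Nat.factorial_succ]
    push_cast
    ring
  rw [Finset.sum_congr rfl h3, Finset.sum_neg_distrib]
  set A := ∑ k ∈ range m, (-1 : ℚ) ^ k * k.factorial * (m - k).factorial
  rw [Nat.factorial_succ] at h2
  simp only [Nat.sub_self, Nat.factorial_zero] at h2 ⊢
  push_cast at h2 ⊢
  field_simp
  linear_combination -h2

lemma hasCycleType_indiscrete_iff {n : ℕ} (hn : 1 ≤ n) (g : Perm (Fin n)) :
    hasCycleType g (Nat.Partition.indiscrete n) ↔ g.IsCycleOn Set.univ := by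
  rw [hasCycleType, Nat.Partition.indiscrete_parts (by omega), Perm.parts_partition,
    Fintype.card_fin]
  rcases Nat.lt_or_ge n 2 with h | h
  · obtain rfl : n = 1 := by omega
    simp [Subsingleton.elim g 1, Perm.isCycleOn_of_subsingleton]
  · rw [← cycleType_eq_singleton_card_iff (by simpa using h), Fintype.card_fin]
    constructor
    · intro heq
      have hmem : n ∈ g.cycleType + Multiset.replicate (n - #g.support) 1 := by simp [heq]
      rw [Multiset.mem_add, Multiset.mem_replicate] at hmem
      have hmem : n ∈ g.cycleType := hmem.resolve_right fun h' => by omega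
      have := congrArg Multiset.card heq
      rw [Multiset.card_add, Multiset.card_singleton] at this
      obtain ⟨x, hx⟩ := Multiset.card_eq_one.1
        (le_antisymm (by omega) (Multiset.card_pos_iff_exists_mem.2 ⟨n, hmem⟩) :
          Multiset.card g.cycleType = 1)
      rw [hx, Multiset.mem_singleton] at hmem
      rw [hx, hmem]
    · intro heq
      have : #g.support = n := by rw [← Perm.sum_cycleType, heq, Multiset.sum_singleton]
      simp [heq, this]

lemma isCycleOn_univ_conj_iff {X : Type*} (e g : Perm X) :
    (e * g * e⁻¹).IsCycleOn Set.univ ↔ g.IsCycleOn Set.univ := by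
  constructor
  · intro h
    have := h.conj (g := e⁻¹)
    simpa [mul_assoc] using this
  · intro h
    have := h.conj (g := e)
    simpa using this

open Classical in
lemma numFactorizations_indiscrete_eq_card {m : ℕ} {σ : Perm (Fin (m + 1))}
    (hσ : σ.IsCycleOn Set.univ) :
    numFactorizations (m + 1) (Nat.Partition.indiscrete (m + 1))
        (Nat.Partition.indiscrete (m + 1)) σ =
      #{α : Perm (Fin (m + 1)) | α.IsCycleOn Set.univ ∧
        (finRotate (m + 1) * α).IsCycleOn Set.univ} := by
  have hiff := hasCycleType_indiscrete_iff (n := m + 1) (by omega)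
  obtain ⟨e, he⟩ : ∃ e, e * finRotate (m + 1) * e⁻¹ = σ := by
    rw [← isConj_iff, Perm.partition_eq_of_isConj]
    exact Nat.Partition.ext (((hiff _).2 (isCycleOn_univ_finRotate m)).trans ((hiff σ).2 hσ).symm)
  rw [numFactorizations, Nat.card_eq_fintype_card, Fintype.card_subtype]
  simp only [hiff]
  refine Finset.card_bij' (fun p _ => e⁻¹ * p.2⁻¹ * e)
    (fun α _ => (e * (finRotate (m + 1) * α) * e⁻¹, e * α⁻¹ * e⁻¹)) ?_ ?_ ?_ ?_
  · rintro ⟨p, q⟩ h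
    simp only [Finset.mem_filter, Finset.mem_univ, true_and] at h ⊢
    obtain ⟨hp, hq, hpq⟩ := h
    rw [← isCycleOn_univ_conj_iff e, ← isCycleOn_univ_conj_iff e (finRotate (m + 1) * _)]
    refine ⟨by simpa [mul_assoc] using hq, ?_⟩
    have : e * (finRotate (m + 1) * (e⁻¹ * q⁻¹ * e)) * e⁻¹ = p := by
      rw [← eq_mul_inv_iff_mul_eq] at hpq
      rw [hpq, ← he]
      simp [mul_assoc]
    rwa [this]
  · intro α h
    simp only [Finset.mem_filter, Finset.mem_univ, true_and] at h ⊢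
    refine ⟨(isCycleOn_univ_conj_iff _ _).2 h.2, (isCycleOn_univ_conj_iff _ _).2 h.1.inv, ?_⟩
    rw [← he]
    simp [mul_assoc]
  · rintro ⟨p, q⟩ h
    simp only [Finset.mem_filter, Finset.mem_univ, true_and] at h
    have hpq := h.2.2
    rw [← eq_mul_inv_iff_mul_eq] at hpq
    rw [hpq, ← he]
    simp [mul_assoc]
  · intro α _
    simp [mul_assoc]

lemma sum_filter_lt_fin (N : ℕ) (f : ℕ → ℕ → ℚ) :
    ∑ p : Fin N × Fin N with p.1 < p.2, f p.1 p.2 = ∑ b ∈ range N, ∑ a ∈ range b, f a b := by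
  rw [Finset.sum_filter, Fintype.sum_prod_type_right, ← Fin.sum_univ_eq_sum_range
    (fun b => ∑ a ∈ range b, f a b)]
  refine Finset.sum_congr rfl fun b _ => ?_
  simp only [Fin.lt_def]
  rw [Fin.sum_univ_eq_sum_range (fun a => if a < (b : ℕ) then f a b else 0), ← Finset.sum_filter]
  refine Finset.sum_congr ?_ fun _ _ => rfl
  ext a
  have := b.2
  simp only [Finset.mem_filter, Finset.mem_range]
  omega

/-- the number of ways to write a fixed n-cycle as an ordered product
of two n-cycles. -/
theorem numFactorizations_cycle_cycle (n : ℕ) (hn : 1 ≤ n)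
    (σ : Equiv.Perm (Fin n)) (hσ : hasCycleType σ (Nat.Partition.indiscrete n)) :
    (numFactorizations n (Nat.Partition.indiscrete n) (Nat.Partition.indiscrete n) σ : ℚ) =
      (1 / (n : ℚ)) * ∑ r ∈ Finset.range n,
        (-1 : ℚ) ^ r * (r.factorial : ℚ) * ((n - 1 - r).factorial : ℚ) := by
  obtain ⟨m, rfl⟩ : ∃ m, n = m + 1 := ⟨n - 1, by omega⟩
  rw [numFactorizations_indiscrete_eq_card ((hasCycleType_indiscrete_iff hn σ).1 hσ),
    ← Int.cast_natCast, card_isCycleOn_finRotate_mul]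
  push_cast
  rw [sum_filter_lt_fin (m + 1) fun a b => (-1 : ℚ) ^ (b - a) *
    ((b - a - 1).factorial * (m - (b - a)).factorial)]
  exact factorial_add_sum_eq m
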